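/- arXiv:2201.04164 — 4 statements merged into one kernel-verified Lean document; each statement's English description precedes it below -/
import Mathlib

section
/- Let G be a finite simple graph, W a minimal vertex cover of G, and {x,y} an edge of G with x ∈ W and y ∉ W. Then for every natural number i with 0 ≤ i ≤ s, the element X(x,i) · X(y,0)^{s+1} belongs to J_s(I(G)); that is, X(x,i) lies in the ideal quotient J_s(I(G)) : (X(y,0))^{s+1}. -/
open MvPolynomial

/-- `W` is a vertex cover of `G`. -/
def IsVertexCover {V : Type*} (G : SimpleGraph V) (W : Set V) : Prop :=
  ∀ ⦃x y : V⦄, G.Adj x y → x ∈ W ∨ y ∈ W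

/-- `W` is a minimal vertex cover of `G`. -/
def IsMinimalVertexCover {V : Type*} (G : SimpleGraph V) (W : Set V) : Prop :=
  IsVertexCover G W ∧ ∀ W' : Set V, W' ⊂ W → ¬ IsVertexCover G W'

/-- The degree `m` part `α_m(x,y) = ∑_{i+j=m} X(x,i)·X(y,j)` of the image of the
edge monomial `xy` in the ring of `s`-jets. -/
noncomputable def jetsAlpha (k : Type*) [Field k] {V : Type*} (s : ℕ) (x y : V) (m : ℕ) :
    MvPolynomial (V × Fin (s + 1)) k :=
  ∑ ij ∈ Finset.univ.filter
      (fun ij : Fin (s + 1) × Fin (s + 1) => (ij.1 : ℕ) + (ij.2 : ℕ) = m),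
    X (x, ij.1) * X (y, ij.2)

/-- The `s`-jets `J_s(I(G))` of the edge ideal of `G`: the ideal generated by all
`α_m(x,y)` with `{x,y}` an edge of `G` and `0 ≤ m ≤ s`. -/
noncomputable def jetsEdgeIdeal (k : Type*) [Field k] {V : Type*} (G : SimpleGraph V)
    (s : ℕ) : Ideal (MvPolynomial (V × Fin (s + 1)) k) :=
  Ideal.span {f | ∃ x y : V, G.Adj x y ∧ ∃ m ≤ s, f = jetsAlpha k s x y m}

theorem X_mul_X_zero_pow_mem_jetsEdgeIdeal (k : Type*) [Field k] {V : Type*}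
    {G : SimpleGraph V} (s : ℕ) {x y : V} (hxy : G.Adj x y) (i : Fin (s + 1)) :
    X (x, i) * X (y, (0 : Fin (s + 1))) ^ ((i : ℕ) + 1) ∈ jetsEdgeIdeal k G s := by
  induction i using WellFoundedLT.induction with
  | ind i ih =>
  have hα : jetsAlpha k s x y i ∈ jetsEdgeIdeal k G s :=
    Ideal.subset_span ⟨x, y, hxy, i, Nat.lt_succ_iff.mp i.isLt, rfl⟩
  have hmem : (i, (0 : Fin (s + 1))) ∈ Finset.univ.filter
      (fun ab : Fin (s + 1) × Fin (s + 1) => (ab.1 : ℕ) + (ab.2 : ℕ) = i) := by simp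
  have hmul := Ideal.mul_mem_right (X (y, (0 : Fin (s + 1))) ^ (i : ℕ)) _ hα
  rw [jetsAlpha, ← Finset.add_sum_erase _ _ hmem, add_mul, Finset.sum_mul,
    Ideal.add_mem_iff_left] at hmul
  · rwa [pow_succ', ← mul_assoc]
  · refine Ideal.sum_mem _ fun ⟨a, b⟩ hab => ?_
    simp only [Finset.mem_erase, ne_eq, Prod.mk.injEq, Finset.mem_filter, Finset.mem_univ,
      true_and, Fin.ext_iff, Fin.val_zero] at hab
    have hlt : (a : ℕ) < i := by omega
    obtain ⟨d, hd⟩ := Nat.exists_eq_add_of_lt hlt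
    convert Ideal.mul_mem_left _ (X (y, b) * X (y, (0 : Fin (s + 1))) ^ d) (ih a hlt) using 1
    rw [hd]
    ring

theorem jets_colon_lemma (k : Type*) [Field k] {V : Type*} [Fintype V]
    (G : SimpleGraph V) (s : ℕ) (W : Set V) (hW : IsMinimalVertexCover G W)
    (x y : V) (hxy : G.Adj x y) (hx : x ∈ W) (hy : y ∉ W) :
    ∀ i : Fin (s + 1),
      X (x, i) * X (y, (0 : Fin (s + 1))) ^ (s + 1) ∈ jetsEdgeIdeal k G s := by
  intro i
  exact Ideal.mem_of_dvd _ (mul_dvd_mul_left _ (pow_dvd_pow _ i.isLt))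
    (X_mul_X_zero_pow_mem_jetsEdgeIdeal k s hxy i)
end

section
/- Let G be a finite simple graph, W a minimal vertex cover of G, and let f = ∏_{y ∉ W} X(y,0) be the product of the 0-th jet variables of the vertices outside W. Then ⟨J_s(W)⟩ equals the saturation of J_s(I(G)) with respect to f; that is, for every g ∈ J_sR, g ∈ ⟨J_s(W)⟩ if and only if there exists a natural number N with g · f^N ∈ J_s(I(G)). -/
open MvPolynomial

/-- `⟨J_s(W)⟩`: the ideal generated by the jets variables of the elements of `W`. -/
noncomputable def jetsVertexCoverIdeal (k : Type*) [Field k] {V : Type*} (s : ℕ)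
    (W : Set V) : Ideal (MvPolynomial (V × Fin (s + 1)) k) :=
  Ideal.span {f | ∃ x ∈ W, ∃ i : Fin (s + 1), f = X (x, i)}

/-- The ideal of elements which some power of `f` multiplies into `I`. -/
def Ideal.saturationBy {R : Type*} [CommRing R] (I : Ideal R) (f : R) : Ideal R where
  carrier := {g | ∃ N : ℕ, g * f ^ N ∈ I}
  zero_mem' := ⟨0, by simp⟩
  add_mem' := by
    rintro a b ⟨m, hm⟩ ⟨n, hn⟩
    refine ⟨m + n, ?_⟩
    have h : (a + b) * f ^ (m + n) = f ^ n * (a * f ^ m) + f ^ m * (b * f ^ n) := by ring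
    rw [h]
    exact I.add_mem (I.mul_mem_left _ hm) (I.mul_mem_left _ hn)
  smul_mem' := by
    rintro c a ⟨n, hn⟩
    refine ⟨n, ?_⟩
    rw [smul_eq_mul, mul_assoc]
    exact I.mul_mem_left _ hn

theorem Ideal.mem_saturationBy {R : Type*} [CommRing R] {I : Ideal R} {f g : R} :
    g ∈ I.saturationBy f ↔ ∃ N : ℕ, g * f ^ N ∈ I :=
  Iff.rfl

theorem Ideal.le_saturationBy {R : Type*} [CommRing R] (I : Ideal R) (f : R) :
    I ≤ I.saturationBy f :=
  fun g hg => ⟨0, by simpa using hg⟩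

theorem Ideal.mem_saturationBy_of_mul_mem {R : Type*} [CommRing R] {I : Ideal R} {f g : R}
    (h : g * f ∈ I.saturationBy f) : g ∈ I.saturationBy f := by
  obtain ⟨N, hN⟩ := h
  exact ⟨N + 1, by rwa [pow_succ', ← mul_assoc]⟩

theorem IsMinimalVertexCover.exists_adj_notMem {V : Type*} {G : SimpleGraph V} {W : Set V}
    (hW : IsMinimalVertexCover G W) {x : V} (hx : x ∈ W) : ∃ y, G.Adj x y ∧ y ∉ W := by
  by_contra! h
  refine hW.2 (W \ {x}) (Set.sdiff_singleton_ssubset.2 hx) fun a b hab => ?_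
  have hba := hab.symm
  have hne := hab.ne
  have hcov := hW.1 hab
  by_cases ha : a = x
  · subst ha
    exact Or.inr ⟨h b hab, hne.symm⟩
  · by_cases hb : b = x
    · subst hb
      exact Or.inl ⟨h a hba, ha⟩
    · exact hcov.imp (⟨·, ha⟩) (⟨·, hb⟩)

section

variable {k : Type*} [Field k] {V : Type*} {s : ℕ}

theorem X_mem_jetsVertexCoverIdeal {W : Set V} {x : V} (hx : x ∈ W) (i : Fin (s + 1)) :
    (X (x, i) : MvPolynomial (V × Fin (s + 1)) k) ∈ jetsVertexCoverIdeal k s W :=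
  Ideal.subset_span ⟨x, hx, i, rfl⟩

theorem jetsEdgeIdeal_le_jetsVertexCoverIdeal {G : SimpleGraph V} {W : Set V}
    (hW : IsVertexCover G W) : jetsEdgeIdeal k G s ≤ jetsVertexCoverIdeal k s W := by
  refine Ideal.span_le.2 ?_
  rintro _ ⟨x, y, hxy, m, -, rfl⟩
  refine Ideal.sum_mem _ fun ij _ => ?_
  rcases hW hxy with h | h
  · exact Ideal.mul_mem_right _ _ (X_mem_jetsVertexCoverIdeal h _)
  · exact Ideal.mul_mem_left _ _ (X_mem_jetsVertexCoverIdeal h _)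

/-- If `I` contains `α_i(x,y)` and the lower jets variables of `x`, then it contains the leading
term `X(x,i)·X(y,0)`. -/
theorem X_mul_X_zero_mem {I : Ideal (MvPolynomial (V × Fin (s + 1)) k)} {x y : V}
    {i : Fin (s + 1)} (hα : jetsAlpha k s x y i ∈ I)
    (hlt : ∀ j < i, (X (x, j) : MvPolynomial (V × Fin (s + 1)) k) ∈ I) :
    (X (x, i) * X (y, 0) : MvPolynomial (V × Fin (s + 1)) k) ∈ I := by
  have hmem : (i, (0 : Fin (s + 1))) ∈ Finset.univ.filter
      (fun ij : Fin (s + 1) × Fin (s + 1) => (ij.1 : ℕ) + (ij.2 : ℕ) = i) := by simp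
  rw [jetsAlpha, ← Finset.add_sum_erase _ _ hmem] at hα
  refine (I.add_mem_iff_left (Ideal.sum_mem _ fun ij hij => ?_)).1 hα
  obtain ⟨a, b⟩ := ij
  simp only [Finset.mem_erase, Finset.mem_filter, Finset.mem_univ, true_and, ne_eq,
    Prod.mk.injEq, not_and, Fin.ext_iff, Fin.val_zero] at hij
  exact I.mul_mem_right _ (hlt a (Fin.lt_def.2 (by grind)))

open Classical in
/-- Setting the jets variables of `W` to zero. -/
noncomputable def jetsVanishOn (k : Type*) [Field k] {V : Type*} (s : ℕ) (W : Set V) :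
    MvPolynomial (V × Fin (s + 1)) k →ₐ[k] MvPolynomial (V × Fin (s + 1)) k :=
  aeval fun p => if p.1 ∈ W then 0 else X p

theorem jetsVanishOn_X_of_mem {W : Set V} {x : V} (hx : x ∈ W) (i : Fin (s + 1)) :
    jetsVanishOn k s W (X (x, i)) = 0 := by
  simp [jetsVanishOn, hx]

theorem jetsVanishOn_X_of_notMem {W : Set V} {x : V} (hx : x ∉ W) (i : Fin (s + 1)) :
    jetsVanishOn k s W (X (x, i)) = X (x, i) := by
  simp [jetsVanishOn, hx]

theorem mem_jetsVertexCoverIdeal_iff {W : Set V} {g : MvPolynomial (V × Fin (s + 1)) k} :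
    g ∈ jetsVertexCoverIdeal k s W ↔ jetsVanishOn k s W g = 0 := by
  constructor
  · intro hg
    have hle : jetsVertexCoverIdeal k s W ≤ RingHom.ker (jetsVanishOn k s W) := by
      refine Ideal.span_le.2 ?_
      rintro _ ⟨x, hx, i, rfl⟩
      exact jetsVanishOn_X_of_mem hx i
    exact hle hg
  · intro hg
    have hcomp : (Ideal.Quotient.mkₐ k (jetsVertexCoverIdeal k s W)).comp (jetsVanishOn k s W) =
        Ideal.Quotient.mkₐ k (jetsVertexCoverIdeal k s W) := by
      refine algHom_ext fun ⟨x, i⟩ => ?_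
      rw [AlgHom.comp_apply]
      by_cases hx : x ∈ W
      · rw [jetsVanishOn_X_of_mem hx, map_zero]
        exact (Ideal.Quotient.eq_zero_iff_mem.2 (X_mem_jetsVertexCoverIdeal hx i)).symm
      · rw [jetsVanishOn_X_of_notMem hx]
    have h := DFunLike.congr_fun hcomp g
    rw [AlgHom.comp_apply, hg, map_zero] at h
    exact Ideal.Quotient.eq_zero_iff_mem.1 h.symm

end

theorem jetsVertexCoverIdeal_eq_saturation (k : Type*) [Field k] {V : Type*} [Fintype V]
    (G : SimpleGraph V) (s : ℕ) (W : Set V) [DecidablePred (· ∈ W)]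
    (hW : IsMinimalVertexCover G W)
    (f : MvPolynomial (V × Fin (s + 1)) k)
    (hf : f = ∏ y ∈ Finset.univ.filter (fun y : V => y ∉ W), X (y, (0 : Fin (s + 1)))) :
    ∀ g : MvPolynomial (V × Fin (s + 1)) k,
      g ∈ jetsVertexCoverIdeal k s W ↔
        ∃ N : ℕ, g * f ^ N ∈ jetsEdgeIdeal k G s := by
  intro g
  constructor
  · intro hg
    suffices h : jetsVertexCoverIdeal k s W ≤ (jetsEdgeIdeal k G s).saturationBy f from
      Ideal.mem_saturationBy.1 (h hg)
    refine Ideal.span_le.2 ?_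
    rintro _ ⟨x, hx, i, rfl⟩
    obtain ⟨y, hxy, hy⟩ := hW.exists_adj_notMem hx
    have hdvd : (X (y, (0 : Fin (s + 1))) : MvPolynomial (V × Fin (s + 1)) k) ∣ f := by
      rw [hf]
      exact Finset.dvd_prod_of_mem (fun y : V => X (y, (0 : Fin (s + 1)))) (by simpa using hy)
    induction i using WellFoundedLT.induction with
    | ind i ih =>
      have hα : jetsAlpha k s x y i ∈ jetsEdgeIdeal k G s :=
        Ideal.subset_span ⟨x, y, hxy, i, Nat.lt_succ_iff.1 i.isLt, rfl⟩
      exact Ideal.mem_saturationBy_of_mul_mem (Ideal.mem_of_dvd _ (mul_dvd_mul_left _ hdvd)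
        (X_mul_X_zero_mem (Ideal.le_saturationBy _ f hα) ih))
  · rintro ⟨N, hN⟩
    have hvanish_f : jetsVanishOn k s W f = f := by
      rw [hf, map_prod]
      exact Finset.prod_congr rfl fun y hy =>
        jetsVanishOn_X_of_notMem (Finset.mem_filter.1 hy).2 0
    have hf_ne : f ≠ 0 := by
      rw [hf]
      exact Finset.prod_ne_zero_iff.2 fun y _ => X_ne_zero _
    have h := mem_jetsVertexCoverIdeal_iff.1 (jetsEdgeIdeal_le_jetsVertexCoverIdeal hW.1 hN)
    rw [map_mul, map_pow, hvanish_f] at h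
    exact mem_jetsVertexCoverIdeal_iff.2 ((mul_eq_zero.1 h).resolve_right (pow_ne_zero _ hf_ne))
end

section
/- Let k be a field, G a finite simple graph on a finite vertex type V, and p : V → k a point of the variety of the edge ideal of G, i.e., p x · p y = 0 for every edge {x,y} of G. Suppose p lies on exactly one irreducible component of this variety, i.e., there is exactly one minimal vertex cover W of G with p x = 0 for all x ∈ W. Then the span of the gradients at p of the edge monomials equals the coordinate subspace determined by W: the k-linear span in (V → k) of the vectors { (p y) • e_x + (p x) • e_y : {x,y} an edge of G } equals the k-linear span of { e_x : x ∈ W }, where e_x denotes the standard basis vector Pi.single x 1. -/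
/-- Every vertex cover of a finite graph contains a minimal vertex cover. -/
lemma IsVertexCover.exists_isMinimalVertexCover_subset {V : Type*} [Finite V]
    {G : SimpleGraph V} {Z : Set V} (hZ : IsVertexCover G Z) :
    ∃ W ⊆ Z, IsMinimalVertexCover G W := by
  obtain ⟨W, hWZ, hW⟩ := exists_minimal_le_of_wellFoundedLT (IsVertexCover G) Z hZ
  exact ⟨W, hWZ, hW.prop, fun _ hlt => hW.not_prop_of_lt hlt⟩

/-- If `W` is the only minimal vertex cover on which `p` vanishes, then every vertex of `W` has a
neighbour at which `p` does not vanish. -/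
lemma exists_adj_ne_zero_of_unique_cover {k V : Type*} [Field k] [Finite V]
    {G : SimpleGraph V} {p : V → k} (hp : ∀ ⦃x y : V⦄, G.Adj x y → p x * p y = 0) {W : Set V}
    (huniq : ∀ W' : Set V, IsMinimalVertexCover G W' → (∀ x ∈ W', p x = 0) → W' = W)
    {x : V} (hx : x ∈ W) : ∃ y, G.Adj x y ∧ p y ≠ 0 := by
  by_contra! h
  have hZ : IsVertexCover G {v | p v = 0 ∧ v ≠ x} := by
    intro a b hab
    by_cases hax : a = x
    · subst hax
      exact Or.inr ⟨h b hab, hab.ne'⟩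
    by_cases hbx : b = x
    · subst hbx
      exact Or.inl ⟨h a hab.symm, hab.ne⟩
    exact (mul_eq_zero.mp (hp hab)).imp (⟨·, hax⟩) (⟨·, hbx⟩)
  obtain ⟨W', hW'Z, hW'⟩ := hZ.exists_isMinimalVertexCover_subset
  have hxW' : x ∈ W' := huniq W' hW' (fun v hv => (hW'Z hv).1) ▸ hx
  exact (hW'Z hxW').2 rfl

/-- At a smooth point of the variety of the edge ideal of a graph (a point lying on
exactly one irreducible component, i.e. vanishing on exactly one minimal vertex cover
`W`), the span of the gradients of the edge monomials equals the coordinate subspace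
determined by `W`. -/
theorem span_gradients_eq_span_cover
    (k : Type*) [Field k] {V : Type*} [Fintype V] [DecidableEq V]
    (G : SimpleGraph V) (p : V → k)
    (hp : ∀ ⦃x y : V⦄, G.Adj x y → p x * p y = 0)
    (W : Set V) (hW : IsMinimalVertexCover G W)
    (hpW : ∀ x ∈ W, p x = 0)
    (huniq : ∀ W' : Set V, IsMinimalVertexCover G W' → (∀ x ∈ W', p x = 0) → W' = W) :
    Submodule.span k
        {v : V → k | ∃ x y : V, G.Adj x y ∧
          v = p y • (Pi.single x 1 : V → k) + p x • (Pi.single y 1 : V → k)} =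
      Submodule.span k {v : V → k | ∃ x ∈ W, v = (Pi.single x 1 : V → k)} := by
  apply le_antisymm
  · rw [Submodule.span_le]
    rintro _ ⟨x, y, hxy, rfl⟩
    have smul_mem : ∀ ⦃a b : V⦄, G.Adj a b → p b • (Pi.single a 1 : V → k) ∈
        Submodule.span k {v : V → k | ∃ x ∈ W, v = (Pi.single x 1 : V → k)} := by
      intro a b hab
      rcases hW.1 hab with ha | hb
      · exact Submodule.smul_mem _ _ (Submodule.subset_span ⟨a, ha, rfl⟩)
      · simp [hpW b hb]
    exact Submodule.add_mem _ (smul_mem hxy) (smul_mem hxy.symm)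
  · rw [Submodule.span_le]
    rintro _ ⟨x, hx, rfl⟩
    obtain ⟨y, hxy, hy⟩ := exists_adj_ne_zero_of_unique_cover hp huniq hx
    rw [SetLike.mem_coe, ← Submodule.smul_mem_iff _ hy]
    exact Submodule.subset_span ⟨x, y, hxy, by simp [hpW x hx]⟩
end

section
/- Let G be a finite simple graph on a vertex type V and s a natural number, and let PC_s(G) be the simple graph on V × Fin(s+1) in which (x,i) is adjacent to (y,j) if and only if x is adjacent to y in G. If G is cochordal (its complement graph Gᶜ is chordal), then PC_s(G) is cochordal; that is, if for every natural number n ≥ 4 there is no graph embedding of the cycle graph on n vertices into Gᶜ, then for every n ≥ 4 there is no graph embedding of the cycle graph on n vertices into (PC_s(G))ᶜ. -/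
/-- A simple graph is chordal if for every `n ≥ 4` there is no embedding of the
cycle graph on `n` vertices into it. -/
def IsChordal {V : Type*} (H : SimpleGraph V) : Prop :=
  ∀ n : ℕ, 4 ≤ n → IsEmpty (SimpleGraph.cycleGraph n ↪g H)

/-- `PC_s(G)`: the simple graph on `V × Fin (s+1)` in which `(x,i)` is adjacent to
`(y,j)` if and only if `x` is adjacent to `y` in `G`. -/
def principalComponentGraph {V : Type*} (G : SimpleGraph V) (s : ℕ) :
    SimpleGraph (V × Fin (s + 1)) :=
  SimpleGraph.comap Prod.fst G

/-- In a cycle of length at least four, two adjacent vertices are never true twins: each has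
a neighbour outside the edge that is not adjacent to the other. -/
theorem cycleGraph_exists_adj_not_adj {n : ℕ} (hn : 4 ≤ n) {a b : Fin n}
    (hab : (SimpleGraph.cycleGraph n).Adj a b) :
    ∃ c, c ≠ b ∧ (SimpleGraph.cycleGraph n).Adj c a ∧ ¬ (SimpleGraph.cycleGraph n).Adj c b := by
  obtain ⟨m, rfl⟩ := Nat.exists_eq_add_of_le' hn
  have h1 : (1 : Fin (m + 4)) ≠ 0 := by simp
  have h2 : (1 + 1 : Fin (m + 4)) ≠ 0 := by
    simp [Fin.ext_iff, Fin.val_add, Nat.mod_eq_of_lt (show 2 < m + 4 by lia)]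
  have h3 : (1 + 1 + 1 : Fin (m + 4)) ≠ 0 := by
    simp [Fin.ext_iff, Fin.val_add, Nat.mod_eq_of_lt (show 3 < m + 4 by lia)]
  simp only [SimpleGraph.cycleGraph_adj] at hab ⊢
  rcases hab with hab | hab
  · obtain rfl := eq_add_of_sub_eq hab
    refine ⟨1 + b + 1, fun h => h2 ?_, Or.inl (by abel), ?_⟩
    · rw [← sub_eq_zero] at h
      rw [← h]; abel
    · rintro (h | h) <;> rw [← sub_eq_zero] at h
      · exact h1 (by rw [← h]; abel)
      · exact h3 (by rw [← neg_eq_zero, ← h]; abel)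
  · obtain rfl := eq_add_of_sub_eq hab
    refine ⟨a - 1, fun h => h2 ?_, Or.inr (by abel), ?_⟩
    · rw [← sub_eq_zero] at h
      rw [← neg_eq_zero, ← h]; abel
    · rintro (h | h) <;> rw [← sub_eq_zero] at h
      · exact h3 (by rw [← neg_eq_zero, ← h]; abel)
      · exact h1 (by rw [← h]; abel)

theorem principalComponentGraph_compl_adj {V : Type*} (G : SimpleGraph V) (s : ℕ)
    (p q : V × Fin (s + 1)) :
    (principalComponentGraph G s)ᶜ.Adj p q ↔ p ≠ q ∧ ¬ G.Adj p.1 q.1 := by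
  simp only [SimpleGraph.compl_adj, principalComponentGraph, SimpleGraph.comap_adj]

/-- If `G` is cochordal then its `s`-order principal component is cochordal. -/
theorem principalComponentGraph_cochordal {V : Type*} [Fintype V]
    (G : SimpleGraph V) (s : ℕ) (hG : IsChordal Gᶜ) :
    IsChordal (principalComponentGraph G s)ᶜ := by
  refine fun n hn => ⟨fun f => ?_⟩
  have hadj : ∀ a b, (SimpleGraph.cycleGraph n).Adj a b ↔ a ≠ b ∧ ¬ G.Adj (f a).1 (f b).1 := by
    intro a b
    rw [← f.map_adj_iff, principalComponentGraph_compl_adj, f.injective.ne_iff]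
  have hinj : Function.Injective fun a => (f a).1 := by
    intro a b (h : (f a).1 = (f b).1)
    by_contra hne
    obtain ⟨c, hcb, hca, hncb⟩ := cycleGraph_exists_adj_not_adj hn
      ((hadj a b).2 ⟨hne, by rw [h]; exact G.irrefl⟩)
    exact hncb ((hadj c b).2 ⟨hcb, h ▸ ((hadj c a).1 hca).2⟩)
  refine (hG n hn).false ⟨⟨fun a => (f a).1, hinj⟩, fun {a b} => ?_⟩
  rw [hadj, SimpleGraph.compl_adj]
  exact and_congr_left' hinj.ne_iff
end
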